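/- Let t_0 < t_1 < ⋯ in ℤ^d (lexicographic order) with t_0 > 0, t_n > 3t_{n-1} for all n ≥ 1, and some t_n with all coordinates positive. Let W = {±t_n : n ≥ 0} ∪ {0}. Then there exists a symmetric subset F of ℤ^d with 0 ∉ F such that (W, F) is a co-minimal pair in ℤ^d. -/

import Mathlib

open Pointwise

/-- `ℤ^d` equipped with the lexicographic order. -/
abbrev Zd (d : ℕ) := Lex (Fin d → ℤ)

/-- the value `t (n-1)` with the convention `t_{-1} = 0`. -/
def tprev {d : ℕ} (t : ℕ → Zd d) : ℕ → Zd d := fun n => if n = 0 then 0 else t (n - 1)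

/-- `I_n = X_{-t_n, -t_{n-1}}`. -/
def Iset {d : ℕ} (t : ℕ → Zd d) (n : ℕ) : Set (Zd d) :=
  {x | -(t n) ≤ x} \ {x | -(tprev t n) ≤ x}

/-- `J_n = X_{-t_n, -t_{n-1} - t_{n-2}}`. -/
def Jset {d : ℕ} (t : ℕ → Zd d) (n : ℕ) : Set (Zd d) :=
  {x | -(t n) ≤ x} \ {x | -(tprev t n + tprev t (n - 1)) ≤ x}

/-- `W = {t_n : n ≥ 0} ∪ {0} ∪ {-t_n : n ≥ 0}`. -/
def Wset {d : ℕ} (t : ℕ → Zd d) : Set (Zd d) :=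
  Set.range t ∪ {0} ∪ -(Set.range t)

/-- `V = {t_n : n ≥ 0} ∪ {-t_n : n ≥ 0}`. -/
def Vset {d : ℕ} (t : ℕ → Zd d) : Set (Zd d) :=
  Set.range t ∪ -(Set.range t)

/-- `(A, B)` is a co-minimal pair: `A + B = G` and removing any single element of
`A` or of `B` destroys the complement property. -/
def IsCoMinimalPair {G : Type*} [AddCommGroup G] (A B : Set G) : Prop :=
  A + B = Set.univ ∧
  (∀ a ∈ A, (A \ {a}) + B ≠ Set.univ) ∧
  (∀ b ∈ B, A + (B \ {b}) ≠ Set.univ)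

namespace LacunaryCoMinimal

variable {G : Type*} [AddCommGroup G]

/-- A finite approximation to a symmetric co-minimal complement of `W`: `carrier` is the part of the
complement built so far and each element of `witness` is privately covered by one element of it. -/
structure Approx (W : Set G) where
  carrier : Finset G
  witness : Finset G
  neg_mem : ∀ f ∈ carrier, -f ∈ carrier
  zero_notMem : (0 : G) ∉ carrier
  existsUnique : ∀ p ∈ witness, ∃! f, f ∈ carrier ∧ f - p ∈ W
  exists_witness : ∀ f ∈ carrier, ∃ p ∈ witness, f - p ∈ W

namespace Approx

variable {W : Set G}

instance : Preorder (Approx W) where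
  le A B := A.carrier ⊆ B.carrier ∧ A.witness ⊆ B.witness
  le_refl _ := ⟨subset_rfl, subset_rfl⟩
  le_trans _ _ _ h k := ⟨h.1.trans k.1, h.2.trans k.2⟩

instance : Inhabited (Approx W) :=
  ⟨⟨∅, ∅, by simp, by simp, by simp, by simp⟩⟩

/-- Declare `x` to be privately covered. -/
def insertWitness [DecidableEq G] (A : Approx W) (x : G)
    (hx : ∃! f, f ∈ A.carrier ∧ f - x ∈ W) : Approx W where
  carrier := A.carrier
  witness := insert x A.witness
  neg_mem := A.neg_mem
  zero_notMem := A.zero_notMem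
  existsUnique := by
    intro p hp
    rcases Finset.mem_insert.1 hp with rfl | hp
    exacts [hx, A.existsUnique p hp]
  exists_witness := fun f hf =>
    let ⟨p, hp, h⟩ := A.exists_witness f hf
    ⟨p, Finset.mem_insert_of_mem hp, h⟩

theorem le_insertWitness [DecidableEq G] (A : Approx W) (x : G)
    (hx : ∃! f, f ∈ A.carrier ∧ f - x ∈ W) : A ≤ A.insertWitness x hx :=
  ⟨subset_rfl, Finset.subset_insert _ _⟩

variable {t : ℕ → G}

theorem exists_insert [DecidableEq G] (hneg : ∀ w ∈ W, -w ∈ W) (htW : ∀ n, t n ∈ W)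
    (hev : ∀ b : G, b ≠ 0 → ∀ᶠ n in Filter.atTop, t n + b ∉ W)
    (A : Approx W) {f : G} (hf : f + f ≠ 0)
    (hfP : ∀ p ∈ A.witness, f - p ∉ W) (hfP' : ∀ p ∈ A.witness, f + p ∉ W) :
    ∃ B : Approx W, A ≤ B ∧ B.carrier = insert f (insert (-f) A.carrier) := by
  have hneg' : ∀ {w}, -w ∈ W → w ∈ W := fun {w} h => by simpa using hneg _ h
  have hfF : f ∉ A.carrier := fun h => by
    obtain ⟨p, hp, h⟩ := A.exists_witness f h
    exact hfP p hp h
  have hev' : ∀ᶠ n in Filter.atTop, (∀ g ∈ A.carrier, t n + (f - g) ∉ W) ∧ t n + (f + f) ∉ W :=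
    ((Filter.eventually_all_finset _).2 fun g hg =>
      hev (f - g) (sub_ne_zero.2 fun h => hfF (h ▸ hg))).and (hev _ hf)
  obtain ⟨m, hm, hm'⟩ := hev'.exists
  have hff : -f ≠ f := fun h => hf (by nth_rewrite 1 [← h]; simp)
  refine ⟨⟨insert f (insert (-f) A.carrier),
    insert (f + t m) (insert (-(f + t m)) A.witness), ?_, ?_, ?_, ?_⟩, ⟨?_, ?_⟩, rfl⟩
  · intro g hg
    simp only [Finset.mem_insert] at hg ⊢
    rcases hg with rfl | rfl | hg
    · simp
    · simp
    · exact .inr (.inr (A.neg_mem g hg))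
  · simp only [Finset.mem_insert, not_or]
    refine ⟨fun h => hf (by simp [← h]), fun h => hf ?_, A.zero_notMem⟩
    rw [neg_eq_zero.1 h.symm, add_zero]
  · intro p hp
    simp only [Finset.mem_insert] at hp
    rcases hp with rfl | rfl | hp
    · refine ⟨f, ⟨by simp, by simpa using hneg _ (htW m)⟩, ?_⟩
      rintro g ⟨hg, hgW⟩
      simp only [Finset.mem_insert] at hg
      rcases hg with rfl | rfl | hg
      · rfl
      · refine (hm' (hneg' ?_)).elim
        convert hgW using 1; abel
      · refine (hm g hg (hneg' ?_)).elim
        convert hgW using 1; abel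
    · refine ⟨-f, ⟨by simp, by simpa using htW m⟩, ?_⟩
      rintro g ⟨hg, hgW⟩
      simp only [Finset.mem_insert] at hg
      rcases hg with rfl | rfl | hg
      · refine (hm' ?_).elim
        convert hgW using 1; abel
      · rfl
      · refine (hm (-g) (A.neg_mem g hg) ?_).elim
        convert hgW using 1; abel
    · obtain ⟨g, ⟨hg, hgW⟩, huniq⟩ := A.existsUnique p hp
      refine ⟨g, ⟨by simp [hg], hgW⟩, ?_⟩
      rintro g' ⟨hg', hgW'⟩
      simp only [Finset.mem_insert] at hg'
      rcases hg' with rfl | rfl | hg'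
      · exact (hfP p hp hgW').elim
      · refine (hfP' p hp (hneg' ?_)).elim
        convert hgW' using 1; abel
      · exact huniq g' ⟨hg', hgW'⟩
  · intro g hg
    simp only [Finset.mem_insert] at hg
    rcases hg with rfl | rfl | hg
    · exact ⟨g + t m, by simp, by simpa using hneg _ (htW m)⟩
    · exact ⟨-(f + t m), by simp, by simpa using htW m⟩
    · obtain ⟨p, hp, h⟩ := A.exists_witness g hg
      exact ⟨p, by simp [hp], h⟩
  · exact (Finset.subset_insert _ _).trans (Finset.subset_insert _ _)
  · exact (Finset.subset_insert _ _).trans (Finset.subset_insert _ _)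

theorem exists_cover (h0 : (0 : G) ∈ W) (hneg : ∀ w ∈ W, -w ∈ W) (htW : ∀ n, t n ∈ W)
    (hev : ∀ b : G, b ≠ 0 → ∀ᶠ n in Filter.atTop, t n + b ∉ W)
    (hev2 : ∀ b : G, ∀ᶠ n in Filter.atTop, t n + t n + b ∉ W) (A : Approx W) (x : G) :
    ∃ B : Approx W, A ≤ B ∧ ∃ f ∈ B.carrier, f - x ∈ W := by
  classical
  by_cases hx : ∃ f ∈ A.carrier, f - x ∈ W
  · exact ⟨A, le_rfl, hx⟩
  have hxp : ∀ p ∈ A.witness, x - p ≠ 0 := by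
    intro p hp h
    obtain ⟨f, hf, -⟩ := A.existsUnique p hp
    exact hx (sub_eq_zero.1 h ▸ ⟨f, hf⟩)
  have hxp' : ∀ p ∈ A.witness, x + p ≠ 0 := by
    intro p hp h
    obtain ⟨f, ⟨hf, hfW⟩, -⟩ := A.existsUnique p hp
    refine hx ⟨-f, A.neg_mem f hf, ?_⟩
    rw [eq_neg_of_add_eq_zero_left h]
    convert hneg _ hfW using 1; abel
  obtain ⟨n, ⟨h1, h2⟩, h3⟩ :=
    ((((Filter.eventually_all_finset _).2 fun p hp => hev _ (hxp p hp)).and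
      ((Filter.eventually_all_finset _).2 fun p hp => hev _ (hxp' p hp))).and
      (hev2 (x + x))).exists
  obtain ⟨B, hAB, hB⟩ := exists_insert hneg htW hev A (f := t n + x)
    (fun h => h3 (by convert h0 using 1; rw [← h]; abel))
    (fun p hp h => h1 p hp (by convert h using 1; abel))
    (fun p hp h => h2 p hp (by convert h using 1; abel))
  exact ⟨B, hAB, t n + x, by simp [hB], by simpa using htW n⟩

theorem exists_private [Infinite G] (h0 : (0 : G) ∈ W) (hneg : ∀ w ∈ W, -w ∈ W)
    (htW : ∀ n, t n ∈ W) (hev : ∀ b : G, b ≠ 0 → ∀ᶠ n in Filter.atTop, t n + b ∉ W)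
    (hev2 : ∀ b : G, ∀ᶠ n in Filter.atTop, t n + t n + b ∉ W) (A : Approx W) {w : G}
    (hw : w ∈ W) : ∃ B : Approx W, A ≤ B ∧ ∃ f ∈ B.carrier, f + w ∈ B.witness := by
  classical
  obtain ⟨c, hc⟩ := Infinite.exists_notMem_finset
    (A.witness ∪ A.witness.image (fun p => -p) ∪ A.carrier.image (fun g => g - w))
  simp only [Finset.mem_union, Finset.mem_image, not_or, not_exists, not_and] at hc
  obtain ⟨⟨hc1, hc2⟩, hc3⟩ := hc
  obtain ⟨n, ⟨⟨⟨h1, h2⟩, h3⟩, h4⟩, h5⟩ :=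
    (((((Filter.eventually_all_finset A.witness).2 fun p hp =>
        hev (c - p) (sub_ne_zero.2 fun h => hc1 (h ▸ hp))).and
      ((Filter.eventually_all_finset A.witness).2 fun p hp =>
        hev (c + p) fun h => hc2 p hp (eq_neg_of_add_eq_zero_left h).symm)).and
      ((Filter.eventually_all_finset A.carrier).2 fun g hg =>
        hev (c + w - g) fun h => hc3 g hg (by rw [← sub_eq_zero.1 h]; abel))).and
      (hev2 (c + c))).and (hev2 (c + c + w)) |>.exists
  obtain ⟨B, hAB, hB⟩ := exists_insert hneg htW hev A (f := t n + c)
    (fun h => h4 (by convert h0 using 1; rw [← h]; abel))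
    (fun p hp h => h1 p hp (by convert h using 1; abel))
    (fun p hp h => h2 p hp (by convert h using 1; abel))
  have hx : ∃! f, f ∈ B.carrier ∧ f - (t n + c + w) ∈ W := by
    refine ⟨t n + c, ⟨by simp [hB], by simpa using hneg _ hw⟩, ?_⟩
    rintro g ⟨hg, hgW⟩
    simp only [hB, Finset.mem_insert] at hg
    rcases hg with rfl | rfl | hg
    · rfl
    · refine (h5 ?_).elim
      convert hneg _ hgW using 1; abel
    · refine (h3 g hg ?_).elim
      convert hneg _ hgW using 1; abel
  exact ⟨B.insertWitness _ hx, hAB.trans (B.le_insertWitness _ hx), t n + c,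
    by simp [insertWitness, hB], by simp [insertWitness]⟩

end Approx

/-- A symmetric subset of a countable group that is sparse along a sequence of its own elements has
a symmetric co-minimal complement avoiding `0`. -/
theorem exists_coMinimal_of_eventually_notMem [Infinite G] [Countable G] {W : Set G} {t : ℕ → G}
    (h0 : (0 : G) ∈ W) (hneg : ∀ w ∈ W, -w ∈ W) (htW : ∀ n, t n ∈ W)
    (hev : ∀ b : G, b ≠ 0 → ∀ᶠ n in Filter.atTop, t n + b ∉ W)
    (hev2 : ∀ b : G, ∀ᶠ n in Filter.atTop, t n + t n + b ∉ W) :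
    ∃ F : Set G, F = -F ∧ (0 : G) ∉ F ∧ IsCoMinimalPair W F := by
  have := Encodable.ofCountable G
  let D : G → Order.Cofinal (Approx W) := fun x =>
    { carrier := {A | (∃ f ∈ A.carrier, f - x ∈ W) ∧
        (x ∈ W → ∃ f ∈ A.carrier, f + x ∈ A.witness)}
      isCofinal := by
        intro A
        obtain ⟨B, hAB, f, hf, hfx⟩ := A.exists_cover h0 hneg htW hev hev2 x
        by_cases hx : x ∈ W
        · obtain ⟨C, hBC, g, hg⟩ := B.exists_private h0 hneg htW hev hev2 hx
          exact ⟨C, ⟨⟨f, hBC.1 hf, hfx⟩, fun _ => ⟨g, hg⟩⟩, hAB.trans hBC⟩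
        · exact ⟨B, ⟨⟨f, hf, hfx⟩, fun h => (hx h).elim⟩, hAB⟩ }
  let I := Order.idealOfCofinals default D
  have hI : ∀ x, ∃ A ∈ I, (∃ f ∈ A.carrier, f - x ∈ W) ∧
      (x ∈ W → ∃ f ∈ A.carrier, f + x ∈ A.witness) := fun x => by
    obtain ⟨A, hA, hAI⟩ := Order.cofinal_meets_idealOfCofinals default D x
    exact ⟨A, hAI, hA⟩
  have huniq : ∀ A ∈ I, ∀ B ∈ I, ∀ C ∈ I, ∀ p ∈ A.witness, ∀ f ∈ B.carrier, ∀ g ∈ C.carrier,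
      f - p ∈ W → g - p ∈ W → f = g := by
    intro A hA B hB C hC p hp f hf g hg hfp hgp
    obtain ⟨E, hE, hAE, hBE⟩ := I.directed A hA B hB
    obtain ⟨H, -, hEH, hCH⟩ := I.directed E hE C hC
    exact (H.existsUnique p (hEH.2 (hAE.2 hp))).unique ⟨hEH.1 (hBE.1 hf), hfp⟩ ⟨hCH.1 hg, hgp⟩
  refine ⟨{f | ∃ A ∈ I, f ∈ A.carrier}, ?_, ?_, ?_, ?_, ?_⟩
  · ext f
    constructor
    · rintro ⟨A, hA, hf⟩
      exact ⟨A, hA, A.neg_mem f hf⟩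
    · rintro ⟨A, hA, hf⟩
      exact ⟨A, hA, by simpa using A.neg_mem _ hf⟩
  · rintro ⟨A, -, h⟩
    exact A.zero_notMem h
  · refine Set.eq_univ_of_forall fun x => ?_
    obtain ⟨A, hA, ⟨f, hf, hfx⟩, -⟩ := hI x
    exact Set.mem_add.2 ⟨-(f - x), hneg _ hfx, f, ⟨A, hA, hf⟩, by abel⟩
  · intro a ha h
    obtain ⟨A, hA, -, hA'⟩ := hI a
    obtain ⟨f, hf, hfa⟩ := hA' ha
    obtain ⟨w, ⟨hw, hwa⟩, g, ⟨B, hB, hg⟩, hwg⟩ :=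
      Set.mem_add.1 (h ▸ Set.mem_univ (f + a) : f + a ∈ _)
    have hfg : f = g := huniq A hA A hA B hB _ hfa f hf g hg (by simpa using hneg _ ha)
      (by rw [← hwg]; simpa using hneg _ hw)
    subst hfg
    exact hwa (add_right_cancel (hwg.trans (add_comm _ _)))
  · rintro b ⟨A, hA, hb⟩ h
    obtain ⟨p, hp, hbp⟩ := A.exists_witness b hb
    obtain ⟨w, hw, g, ⟨⟨B, hB, hg⟩, hgb⟩, hwg⟩ := Set.mem_add.1 (h ▸ Set.mem_univ p : p ∈ _)
    exact hgb (huniq A hA A hA B hB p hp b hb g hg hbp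
      (by rw [← hwg]; simpa using hneg _ hw)).symm

end LacunaryCoMinimal

section Lacunary

variable {G : Type*} [AddCommGroup G] [LinearOrder G] {t : ℕ → G}

theorem eventually_abs_lt_of_cofinal (hmono : StrictMono t) (hcof : ∀ x, ∃ n, x < t n) (b : G) :
    ∀ᶠ n in Filter.atTop, |b| < t n := by
  obtain ⟨N, hN⟩ := hcof |b|
  filter_upwards [Filter.eventually_ge_atTop N] with n hn
  exact hN.trans_le (hmono.monotone hn)

variable [IsOrderedAddMonoid G]

theorem notMem_lacunary_of_between (hmono : StrictMono t) (hpos : 0 < t 0) {x : G} {n : ℕ}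
    (h : t n < x) (h' : x < t (n + 1)) : x ∉ Set.range t ∪ {0} ∪ -(Set.range t) := by
  have ht : ∀ k, 0 < t k := fun k => hpos.trans_le (hmono.monotone k.zero_le)
  rintro ((⟨m, rfl⟩ | hx) | ⟨m, hm⟩)
  · have := hmono.lt_iff_lt.1 h
    have := hmono.lt_iff_lt.1 h'
    omega
  · exact ((ht n).trans h).ne' hx
  · have := (ht m).trans_eq hm
    exact (neg_pos.1 this).not_gt ((ht n).trans h)

theorem eventually_add_notMem_lacunary (hmono : StrictMono t) (hpos : 0 < t 0)
    (hgrow : ∀ n, 3 • t n < t (n + 1)) (hcof : ∀ x, ∃ n, x < t n) (b : G) (hb : b ≠ 0) :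
    ∀ᶠ n in Filter.atTop, t n + b ∉ Set.range t ∪ {0} ∪ -(Set.range t) := by
  obtain ⟨N, hN⟩ := Filter.eventually_atTop.1 (eventually_abs_lt_of_cofinal hmono hcof b)
  filter_upwards [Filter.eventually_ge_atTop (N + 1)] with n hn
  obtain ⟨k, rfl⟩ := Nat.exists_eq_add_of_le' (show 1 ≤ n by omega)
  obtain ⟨h1, h2⟩ := abs_lt.1 (hN k (by omega))
  have hk : 0 < t k := hpos.trans_le (hmono.monotone k.zero_le)
  have hg := hgrow k
  have hg' := hgrow (k + 1)
  have hk' := hmono k.lt_succ_self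
  have e : ∀ a : G, 3 • a = a + a + a := fun a => by abel
  rw [e] at hg hg'
  rcases hb.lt_or_gt with hb | hb
  · refine notMem_lacunary_of_between hmono hpos (n := k) ?_ (add_lt_of_neg_right _ hb)
    calc t k < t k + t k := lt_add_of_pos_right _ hk
      _ = t k + t k + t k + -t k := by abel
      _ < t (k + 1) + b := add_lt_add hg h1
  · refine notMem_lacunary_of_between hmono hpos (n := k + 1) (lt_add_of_pos_right _ hb) ?_
    calc t (k + 1) + b < t (k + 1) + t (k + 1) := by gcongr; exact h2.trans hk'
      _ < t (k + 1) + t (k + 1) + t (k + 1) := lt_add_of_pos_right _ (hk.trans hk')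
      _ < _ := hg'

theorem eventually_add_self_add_notMem_lacunary (hmono : StrictMono t) (hpos : 0 < t 0)
    (hgrow : ∀ n, 3 • t n < t (n + 1)) (hcof : ∀ x, ∃ n, x < t n) (b : G) :
    ∀ᶠ n in Filter.atTop, t n + t n + b ∉ Set.range t ∪ {0} ∪ -(Set.range t) := by
  filter_upwards [eventually_abs_lt_of_cofinal hmono hcof b] with n hn
  obtain ⟨h1, h2⟩ := abs_lt.1 hn
  refine notMem_lacunary_of_between hmono hpos (n := n) ?_ (lt_trans ?_ (hgrow n))
  · rw [add_assoc, lt_add_iff_pos_right]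
    exact neg_lt_iff_pos_add'.1 h1
  · rw [show 3 • t n = t n + t n + t n by abel]
    gcongr

end Lacunary

theorem Zd.exists_lt_of_growth {d : ℕ} (hd : 0 < d) {t : ℕ → Zd d}
    (hgrow : ∀ n : ℕ, 3 • t n < t (n + 1))
    (hcoord : ∃ n : ℕ, ∀ i : Fin d, 0 < ofLex (t n) i) (x : Zd d) : ∃ n, x < t n := by
  obtain ⟨N, hN⟩ := hcoord
  have head_le : ∀ {u v : Zd d}, u < v → ofLex u ⟨0, hd⟩ ≤ ofLex v ⟨0, hd⟩ := by
    rintro u v ⟨i, hi, hlt⟩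
    rcases eq_or_ne i ⟨0, hd⟩ with rfl | hne
    · exact hlt.le
    · exact (hi _ (lt_of_le_of_ne (Fin.mk_le_of_le_val (Nat.zero_le _)) hne.symm)).le
  have hk : ∀ k : ℕ, (k : ℤ) < ofLex (t (N + k)) ⟨0, hd⟩ := by
    intro k
    induction k with
    | zero => exact hN _
    | succ k ih =>
      have h : (3 • ofLex (t (N + k))) ⟨0, hd⟩ ≤ _ := head_le (hgrow (N + k))
      rw [Pi.smul_apply, nsmul_eq_mul] at h
      push_cast at h ⊢
      rw [← add_assoc]
      omega
  refine ⟨N + (ofLex x ⟨0, hd⟩).toNat, ⟨0, hd⟩, fun j hj => ?_, ?_⟩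
  · exact absurd hj (Nat.not_lt_zero _)
  · exact (Int.self_le_toNat _).trans_lt (hk _)

theorem stmt8 {d : ℕ} (hd : 0 < d) (t : ℕ → Zd d) (hmono : StrictMono t)
    (hpos : 0 < t 0) (hgrow : ∀ n : ℕ, 3 • t n < t (n + 1))
    (hcoord : ∃ n : ℕ, ∀ i : Fin d, 0 < ofLex (t n) i) :
    ∃ F : Set (Zd d), F = -F ∧ (0 : Zd d) ∉ F ∧ IsCoMinimalPair (Wset t) F := by
  have hcof := Zd.exists_lt_of_growth hd hgrow hcoord
  have : Infinite (Zd d) := Infinite.of_injective t hmono.injective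
  have : Countable (Zd d) := inferInstanceAs (Countable (Fin d → ℤ))
  refine LacunaryCoMinimal.exists_coMinimal_of_eventually_notMem (t := t) (.inl (.inr rfl)) ?_
    (fun n => .inl (.inl ⟨n, rfl⟩)) (eventually_add_notMem_lacunary hmono hpos hgrow hcof)
    (eventually_add_self_add_notMem_lacunary hmono hpos hgrow hcof)
  rintro w ((hw | rfl) | hw)
  · exact .inr (by simpa using hw)
  · exact .inl (.inr neg_zero)
  · exact .inl (.inl hw)
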